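/- Let G be a 2-player stage game and let I = { (i, j) ∈ A₁ × A₂ : u₂(i, j) = max_{j′ ∈ A₂} u₂(i, j′) } be the set of pure strategy profiles where player 2 plays a best response. Suppose (1) |V₁^{m,m}| > 1 and |V₂^{m,m}| = 1; (2) there do not exist â₁ ∈ A₁, σ̂₂ ∈ ΔA₂, a₁′ ∈ A₁ with u₁(â₁, σ̂₂) < u₁(a₁′, σ̂₂) and σ̂₂ a best response to â₁; and (3) there do not exist a₁ ∈ A₁ and distinct a₂, a₂′ ∈ A₂ that are both best responses to a₁. Then: (a) I ⊆ Nash^{m,m}(G); (b) for each i ∈ A₁ there is a unique j ∈ A₂ with (i, j) ∈ I; (c) there exists b ∈ ℝ such that u₂(i, j) = b for all (i, j) ∈ I and u₂(i′, j′) < b for all (i′, j′) ∉ I; and (d) there exist (i, j), (i′, j′) ∈ I with u₁(i, j) ≠ u₁(i′, j′), i ≠ i′, and j ≠ j′. -/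

import Mathlib

open Finset

/-- A mixed strategy on a finite action set: a probability distribution. -/
structure Mix (A : Type*) [Fintype A] where
  p : A → ℝ
  nonneg : ∀ a, 0 ≤ p a
  sum_one : ∑ a, p a = 1

namespace Mix

/-- The Dirac (pure) mixed strategy at an action. -/
def pure {A : Type*} [Fintype A] [DecidableEq A] (a : A) : Mix A where
  p := fun b => if b = a then 1 else 0
  nonneg := by intro b; by_cases hb : b = a <;> simp [hb]
  sum_one := by simp

/-- The support of a mixed strategy. -/
def support {A : Type*} [Fintype A] (σ : Mix A) : Set A := {a | 0 < σ.p a}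

end Mix

section TwoPlayer

variable {A₁ A₂ : Type*} [Fintype A₁] [Fintype A₂] [DecidableEq A₁] [DecidableEq A₂]

/-- Expected payoff under a mixed strategy profile. -/
def expPay (u : A₁ → A₂ → ℝ) (σ₁ : Mix A₁) (σ₂ : Mix A₂) : ℝ :=
  ∑ a₁, ∑ a₂, σ₁.p a₁ * σ₂.p a₂ * u a₁ a₂

/-- Player 1's pure action `a₁` is a best response among pure strategies to `a₂`. -/
def BR1p (u₁ : A₁ → A₂ → ℝ) (a₁ : A₁) (a₂ : A₂) : Prop := ∀ b₁, u₁ b₁ a₂ ≤ u₁ a₁ a₂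

/-- Player 2's pure action `a₂` is a best response among pure strategies to `a₁`. -/
def BR2p (u₂ : A₁ → A₂ → ℝ) (a₁ : A₁) (a₂ : A₂) : Prop := ∀ b₂, u₂ a₁ b₂ ≤ u₂ a₁ a₂

/-- Player 1's mixed strategy `σ₁` is a best response (among mixed strategies) to `σ₂`. -/
def BR1m (u₁ : A₁ → A₂ → ℝ) (σ₁ : Mix A₁) (σ₂ : Mix A₂) : Prop :=
  ∀ τ₁ : Mix A₁, expPay u₁ τ₁ σ₂ ≤ expPay u₁ σ₁ σ₂

/-- Player 2's mixed strategy `σ₂` is a best response (among mixed strategies) to `σ₁`. -/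
def BR2m (u₂ : A₁ → A₂ → ℝ) (σ₁ : Mix A₁) (σ₂ : Mix A₂) : Prop :=
  ∀ τ₂ : Mix A₂, expPay u₂ σ₁ τ₂ ≤ expPay u₂ σ₁ σ₂

/-- Player 2's pure action `a₂` is a best response among pure strategies to mixed `σ₁`. -/
def BR2pm (u₂ : A₁ → A₂ → ℝ) (σ₁ : Mix A₁) (a₂ : A₂) : Prop :=
  ∀ b₂ : A₂, expPay u₂ σ₁ (Mix.pure b₂) ≤ expPay u₂ σ₁ (Mix.pure a₂)

/-- Pure Nash equilibria (both players restricted to pure strategies). -/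
def NashPP (u₁ u₂ : A₁ → A₂ → ℝ) : Set (A₁ × A₂) :=
  {q | BR1p u₁ q.1 q.2 ∧ BR2p u₂ q.1 q.2}

/-- Nash equilibria when player 1 is mixed and player 2 is pure. -/
def NashMP (u₁ u₂ : A₁ → A₂ → ℝ) : Set (Mix A₁ × A₂) :=
  {q | BR1m u₁ q.1 (Mix.pure q.2) ∧ BR2pm u₂ q.1 q.2}

/-- Mixed Nash equilibria. -/
def NashMM (u₁ u₂ : A₁ → A₂ → ℝ) : Set (Mix A₁ × Mix A₂) :=
  {q | BR1m u₁ q.1 q.2 ∧ BR2m u₂ q.1 q.2}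

def V1pp (u₁ u₂ : A₁ → A₂ → ℝ) : Set ℝ := (fun q => u₁ q.1 q.2) '' NashPP u₁ u₂
def V2pp (u₁ u₂ : A₁ → A₂ → ℝ) : Set ℝ := (fun q => u₂ q.1 q.2) '' NashPP u₁ u₂
def V1mp (u₁ u₂ : A₁ → A₂ → ℝ) : Set ℝ :=
  (fun q => expPay u₁ q.1 (Mix.pure q.2)) '' NashMP u₁ u₂
def V2mp (u₁ u₂ : A₁ → A₂ → ℝ) : Set ℝ :=
  (fun q => expPay u₂ q.1 (Mix.pure q.2)) '' NashMP u₁ u₂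
def V1mm (u₁ u₂ : A₁ → A₂ → ℝ) : Set ℝ := (fun q => expPay u₁ q.1 q.2) '' NashMM u₁ u₂
def V2mm (u₁ u₂ : A₁ → A₂ → ℝ) : Set ℝ := (fun q => expPay u₂ q.1 q.2) '' NashMM u₁ u₂

/-- The set `V` is a singleton, i.e. `|V| = 1`. -/
def oneVal (V : Set ℝ) : Prop := ∃ v, V = {v}

/-- A history of play: a finite sequence of pure action profiles. -/
abbrev Hist (A₁ A₂ : Type*) := List (A₁ × A₂)

/-- A pure behavior strategy for player 1, seen as a mixed behavior strategy. -/
def pureBeh1 (μ : Hist A₁ A₂ → A₁) : Hist A₁ A₂ → Mix A₁ := fun h => Mix.pure (μ h)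

/-- A pure behavior strategy for player 2, seen as a mixed behavior strategy. -/
def pureBeh2 (μ : Hist A₁ A₂ → A₂) : Hist A₁ A₂ → Mix A₂ := fun h => Mix.pure (μ h)

/-- Expected total payoff (w.r.t. `u`) over `T` remaining rounds, after history `h`. -/
def totPay (u : A₁ → A₂ → ℝ) (μ₁ : Hist A₁ A₂ → Mix A₁) (μ₂ : Hist A₁ A₂ → Mix A₂) :
    ℕ → Hist A₁ A₂ → ℝ
  | 0, _ => 0
  | T + 1, h =>
      ∑ a₁, ∑ a₂, (μ₁ h).p a₁ * (μ₂ h).p a₂ * (u a₁ a₂ + totPay u μ₁ μ₂ T (h ++ [(a₁, a₂)]))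

/-- The behavior strategy induced on the subgame following history `h`. -/
def condS {A₁ A₂ α : Type*} (μ : Hist A₁ A₂ → α) (h : Hist A₁ A₂) : Hist A₁ A₂ → α :=
  fun h' => μ (h ++ h')

/-- Nash equilibrium of the `T`-round repeated game, both players mixed. -/
def isNEmm (u₁ u₂ : A₁ → A₂ → ℝ) (T : ℕ)
    (μ₁ : Hist A₁ A₂ → Mix A₁) (μ₂ : Hist A₁ A₂ → Mix A₂) : Prop :=
  (∀ μ₁' : Hist A₁ A₂ → Mix A₁, totPay u₁ μ₁' μ₂ T [] ≤ totPay u₁ μ₁ μ₂ T []) ∧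
  (∀ μ₂' : Hist A₁ A₂ → Mix A₂, totPay u₂ μ₁ μ₂' T [] ≤ totPay u₂ μ₁ μ₂ T [])

/-- Subgame-perfect equilibrium of the `T`-round repeated game, both players mixed. -/
def isSPEmm (u₁ u₂ : A₁ → A₂ → ℝ) (T : ℕ)
    (μ₁ : Hist A₁ A₂ → Mix A₁) (μ₂ : Hist A₁ A₂ → Mix A₂) : Prop :=
  ∀ h : Hist A₁ A₂, h.length < T → isNEmm u₁ u₂ (T - h.length) (condS μ₁ h) (condS μ₂ h)

/-- Nash equilibrium of the `T`-round repeated game, player 1 mixed and player 2 pure. -/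
def isNEmp (u₁ u₂ : A₁ → A₂ → ℝ) (T : ℕ)
    (μ₁ : Hist A₁ A₂ → Mix A₁) (μ₂ : Hist A₁ A₂ → A₂) : Prop :=
  (∀ μ₁' : Hist A₁ A₂ → Mix A₁,
      totPay u₁ μ₁' (pureBeh2 μ₂) T [] ≤ totPay u₁ μ₁ (pureBeh2 μ₂) T []) ∧
  (∀ μ₂' : Hist A₁ A₂ → A₂,
      totPay u₂ μ₁ (pureBeh2 μ₂') T [] ≤ totPay u₂ μ₁ (pureBeh2 μ₂) T [])

/-- SPE of the `T`-round repeated game, player 1 mixed and player 2 pure. -/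
def isSPEmp (u₁ u₂ : A₁ → A₂ → ℝ) (T : ℕ)
    (μ₁ : Hist A₁ A₂ → Mix A₁) (μ₂ : Hist A₁ A₂ → A₂) : Prop :=
  ∀ h : Hist A₁ A₂, h.length < T → isNEmp u₁ u₂ (T - h.length) (condS μ₁ h) (condS μ₂ h)

/-- Nash equilibrium of the `T`-round repeated game, both players pure. -/
def isNEpp (u₁ u₂ : A₁ → A₂ → ℝ) (T : ℕ)
    (μ₁ : Hist A₁ A₂ → A₁) (μ₂ : Hist A₁ A₂ → A₂) : Prop :=
  (∀ μ₁' : Hist A₁ A₂ → A₁,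
      totPay u₁ (pureBeh1 μ₁') (pureBeh2 μ₂) T [] ≤
        totPay u₁ (pureBeh1 μ₁) (pureBeh2 μ₂) T []) ∧
  (∀ μ₂' : Hist A₁ A₂ → A₂,
      totPay u₂ (pureBeh1 μ₁) (pureBeh2 μ₂') T [] ≤
        totPay u₂ (pureBeh1 μ₁) (pureBeh2 μ₂) T [])

/-- SPE of the `T`-round repeated game, both players pure. -/
def isSPEpp (u₁ u₂ : A₁ → A₂ → ℝ) (T : ℕ)
    (μ₁ : Hist A₁ A₂ → A₁) (μ₂ : Hist A₁ A₂ → A₂) : Prop :=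
  ∀ h : Hist A₁ A₂, h.length < T → isNEpp u₁ u₂ (T - h.length) (condS μ₁ h) (condS μ₂ h)

/-- `G ∈ 𝒢_LS^{p,p}`: local suboptimality occurs in some SPE of some `G(T)`,
both players restricted to pure strategies. -/
def GLSpp (u₁ u₂ : A₁ → A₂ → ℝ) : Prop :=
  ∃ T : ℕ, 1 ≤ T ∧ ∃ (μ₁ : Hist A₁ A₂ → A₁) (μ₂ : Hist A₁ A₂ → A₂),
    isSPEpp u₁ u₂ T μ₁ μ₂ ∧ ∃ h : Hist A₁ A₂, h.length < T ∧ (μ₁ h, μ₂ h) ∉ NashPP u₁ u₂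

/-- `G ∈ 𝒢_LS^{m,p}`: local suboptimality occurs in some SPE of some `G(T)`,
player 1 mixed and player 2 pure. -/
def GLSmp (u₁ u₂ : A₁ → A₂ → ℝ) : Prop :=
  ∃ T : ℕ, 1 ≤ T ∧ ∃ (μ₁ : Hist A₁ A₂ → Mix A₁) (μ₂ : Hist A₁ A₂ → A₂),
    isSPEmp u₁ u₂ T μ₁ μ₂ ∧ ∃ h : Hist A₁ A₂, h.length < T ∧ (μ₁ h, μ₂ h) ∉ NashMP u₁ u₂

/-- `G ∈ 𝒢_LS^{m,m}`: local suboptimality occurs in some SPE of some `G(T)`,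
both players mixed. -/
def GLSmm (u₁ u₂ : A₁ → A₂ → ℝ) : Prop :=
  ∃ T : ℕ, 1 ≤ T ∧ ∃ (μ₁ : Hist A₁ A₂ → Mix A₁) (μ₂ : Hist A₁ A₂ → Mix A₂),
    isSPEmm u₁ u₂ T μ₁ μ₂ ∧ ∃ h : Hist A₁ A₂, h.length < T ∧ (μ₁ h, μ₂ h) ∉ NashMM u₁ u₂

/-- The pure-pure characterization condition (condition of the pure-strategy theorem). -/
def condPP (u₁ u₂ : A₁ → A₂ → ℝ) : Prop :=
  ((V1pp u₁ u₂).Nontrivial ∧ (V2pp u₁ u₂).Nontrivial ∧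
    ∃ (a₁ : A₁) (a₂ : A₂), (a₁, a₂) ∉ NashPP u₁ u₂) ∨
  ((V1pp u₁ u₂).Nontrivial ∧ oneVal (V2pp u₁ u₂) ∧
    ∃ (a₁ a₁' : A₁) (a₂ : A₂), u₁ a₁ a₂ < u₁ a₁' a₂ ∧ BR2p u₂ a₁ a₂) ∨
  (oneVal (V1pp u₁ u₂) ∧ (V2pp u₁ u₂).Nontrivial ∧
    ∃ (a₁ : A₁) (a₂ a₂' : A₂), u₂ a₁ a₂ < u₂ a₁ a₂' ∧ BR1p u₁ a₁ a₂)

/-- The mixed-mixed characterization condition (condition of the general-case theorem). -/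
def condMM (u₁ u₂ : A₁ → A₂ → ℝ) : Prop :=
  ((V1mm u₁ u₂).Nontrivial ∧ (V2mm u₁ u₂).Nontrivial ∧
    ∃ (σ₁ : Mix A₁) (σ₂ : Mix A₂), (σ₁, σ₂) ∉ NashMM u₁ u₂) ∨
  ((V1mm u₁ u₂).Nontrivial ∧ oneVal (V2mm u₁ u₂) ∧
    ∃ (σ₁ : Mix A₁) (σ₂ : Mix A₂) (a₁' : A₁),
      expPay u₁ σ₁ σ₂ < expPay u₁ (Mix.pure a₁') σ₂ ∧ BR2m u₂ σ₁ σ₂) ∨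
  (oneVal (V1mm u₁ u₂) ∧ (V2mm u₁ u₂).Nontrivial ∧
    ∃ (σ₁ : Mix A₁) (σ₂ : Mix A₂) (a₂' : A₂),
      expPay u₂ σ₁ σ₂ < expPay u₂ σ₁ (Mix.pure a₂') ∧ BR1m u₁ σ₁ σ₂)

/-- The set `D` of differences of player 1's payoffs between pairs of stage-game
Nash equilibria (mixed-pure case). -/
def Dmp (u₁ u₂ : A₁ → A₂ → ℝ) : Set ℝ :=
  {x | ∃ q ∈ NashMP u₁ u₂, ∃ q' ∈ NashMP u₁ u₂,
    x = expPay u₁ q.1 (Mix.pure q.2) - expPay u₁ q'.1 (Mix.pure q'.2)}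

/-- `x` is a finite (possibly empty) sum of elements of `D`. -/
def sumOfD (D : Set ℝ) (x : ℝ) : Prop :=
  ∃ (n : ℕ) (d : Fin n → ℝ), (∀ k, d k ∈ D) ∧ x = ∑ k, d k

/-- The mixed-pure characterization condition (condition of the
pure-strategy-against-mixed-strategy theorem). -/
def condMP (u₁ u₂ : A₁ → A₂ → ℝ) : Prop :=
  ((V1mp u₁ u₂).Nontrivial ∧ (V2mp u₁ u₂).Nontrivial ∧
    ∃ (σ₁ : Mix A₁) (a₂ : A₂), (σ₁, a₂) ∉ NashMP u₁ u₂) ∨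
  ((V1mp u₁ u₂).Nontrivial ∧ oneVal (V2mp u₁ u₂) ∧
    ∃ (σ₁ : Mix A₁) (a₁' : A₁) (a₂ : A₂),
      expPay u₁ σ₁ (Mix.pure a₂) < u₁ a₁' a₂ ∧
      BR2pm u₂ σ₁ a₂ ∧
      (σ₁.support.Nontrivial →
        ∃ a ∈ σ₁.support, ∀ a' ∈ σ₁.support, a' ≠ a →
          sumOfD (Dmp u₁ u₂) (u₁ a a₂ - u₁ a' a₂))) ∨
  (oneVal (V1mp u₁ u₂) ∧ (V2mp u₁ u₂).Nontrivial ∧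
    ∃ (σ₁ : Mix A₁) (a₂ a₂' : A₂),
      expPay u₂ σ₁ (Mix.pure a₂) < expPay u₂ σ₁ (Mix.pure a₂') ∧
      BR1m u₁ σ₁ (Mix.pure a₂))

/-- A history is reachable under the behavior profile `(μ₁, μ₂)` (mixed-pure case):
every action of player 1 along it has positive probability and every action of
player 2 along it is the prescribed one. -/
def reachableMP (μ₁ : Hist A₁ A₂ → Mix A₁) (μ₂ : Hist A₁ A₂ → A₂) (h : Hist A₁ A₂) : Prop :=
  ∀ k : Fin h.length, 0 < (μ₁ (h.take k.val)).p (h.get k).1 ∧ μ₂ (h.take k.val) = (h.get k).2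

end TwoPlayer

section ExpectedPayoff
variable {A₁ A₂ : Type*} [Fintype A₁] [Fintype A₂]

theorem expPay_pure_left [DecidableEq A₁] (u : A₁ → A₂ → ℝ) (i : A₁) (σ₂ : Mix A₂) :
    expPay u (Mix.pure i) σ₂ = ∑ j, σ₂.p j * u i j := by
  rw [expPay, Finset.sum_comm]
  simp [Mix.pure]

theorem expPay_pure_right [DecidableEq A₂] (u : A₁ → A₂ → ℝ) (σ₁ : Mix A₁) (j : A₂) :
    expPay u σ₁ (Mix.pure j) = ∑ i, σ₁.p i * u i j := by
  simp [expPay, Mix.pure]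

theorem expPay_pure_pure [DecidableEq A₁] [DecidableEq A₂] (u : A₁ → A₂ → ℝ)
    (i : A₁) (j : A₂) :
    expPay u (Mix.pure i) (Mix.pure j) = u i j := by
  rw [expPay_pure_right]
  simp [Mix.pure]

theorem expPay_const (σ₁ : Mix A₁) (σ₂ : Mix A₂) (c : ℝ) :
    expPay (fun _ _ => c) σ₁ σ₂ = c := by
  simp [expPay, ← Finset.sum_mul, ← Finset.mul_sum, σ₁.sum_one, σ₂.sum_one]

theorem Mix.sum_mul_le_of_le {A : Type*} [Fintype A] (σ : Mix A) {f : A → ℝ} {c : ℝ}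
    (hf : ∀ a, f a ≤ c) : ∑ a, σ.p a * f a ≤ c :=
  calc ∑ a, σ.p a * f a ≤ ∑ a, σ.p a * c :=
        Finset.sum_le_sum fun a _ => mul_le_mul_of_nonneg_left (hf a) (σ.nonneg a)
    _ = c := by rw [← Finset.sum_mul, σ.sum_one, one_mul]

theorem BR1p.br1m_pure [DecidableEq A₁] [DecidableEq A₂] {u₁ : A₁ → A₂ → ℝ}
    {i : A₁} {j : A₂} (h : BR1p u₁ i j) :
    BR1m u₁ (Mix.pure i) (Mix.pure j) := fun τ => by
  rw [expPay_pure_pure, expPay_pure_right]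
  exact τ.sum_mul_le_of_le h

theorem BR2p.br2m_pure [DecidableEq A₁] [DecidableEq A₂] {u₂ : A₁ → A₂ → ℝ}
    {i : A₁} {j : A₂} (h : BR2p u₂ i j) :
    BR2m u₂ (Mix.pure i) (Mix.pure j) := fun τ => by
  rw [expPay_pure_pure, expPay_pure_left]
  exact τ.sum_mul_le_of_le h

/-- If the expected payoff attains an upper bound `b` of the payoffs, then every profile played
with nonzero probability has payoff `b`. -/
theorem eq_of_expPay_eq_of_le {u : A₁ → A₂ → ℝ} {σ₁ : Mix A₁} {σ₂ : Mix A₂} {b : ℝ}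
    (hle : ∀ i j, u i j ≤ b) (h : expPay u σ₁ σ₂ = b) {i : A₁} {j : A₂}
    (hij : σ₁.p i * σ₂.p j ≠ 0) : u i j = b := by
  have hterm : ∀ i j, σ₁.p i * σ₂.p j * u i j ≤ σ₁.p i * σ₂.p j * b := fun i j =>
    mul_le_mul_of_nonneg_left (hle i j) (mul_nonneg (σ₁.nonneg i) (σ₂.nonneg j))
  have hsum : ∑ i, ∑ j, σ₁.p i * σ₂.p j * u i j = ∑ i, ∑ j, σ₁.p i * σ₂.p j * b :=
    h.trans (expPay_const σ₁ σ₂ b).symm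
  have hrow := (Finset.sum_eq_sum_iff_of_le fun i _ =>
    Finset.sum_le_sum fun j _ => hterm i j).1 hsum i (Finset.mem_univ i)
  have hcell := (Finset.sum_eq_sum_iff_of_le fun j _ => hterm i j).1 hrow j (Finset.mem_univ j)
  exact mul_left_cancel₀ hij hcell

end ExpectedPayoff

section TwoPlayer
variable {A₁ A₂ : Type*} [Fintype A₁] [Fintype A₂] [DecidableEq A₁] [DecidableEq A₂]
variable [Nonempty A₁] [Nonempty A₂]

/-- Lemma (matrix lemma): structure of the set `I` of pure profiles where player 2
best-responds, under `|V₁^{m,m}| > 1`, `|V₂^{m,m}| = 1`, and conditions (2), (3). -/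
theorem matrix_lemma (u₁ u₂ : A₁ → A₂ → ℝ)
    (hV1 : (V1mm u₁ u₂).Nontrivial) (hV2 : oneVal (V2mm u₁ u₂))
    (h2 : ¬ ∃ (a₁ : A₁) (σ₂ : Mix A₂) (a₁' : A₁),
        expPay u₁ (Mix.pure a₁) σ₂ < expPay u₁ (Mix.pure a₁') σ₂ ∧
        BR2m u₂ (Mix.pure a₁) σ₂)
    (h3 : ¬ ∃ (a₁ : A₁) (a₂ a₂' : A₂), a₂ ≠ a₂' ∧ BR2p u₂ a₁ a₂ ∧ BR2p u₂ a₁ a₂') :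
    (∀ q : A₁ × A₂, BR2p u₂ q.1 q.2 → (Mix.pure q.1, Mix.pure q.2) ∈ NashMM u₁ u₂) ∧
    (∀ i : A₁, ∃! j : A₂, BR2p u₂ i j) ∧
    (∃ b : ℝ, (∀ q : A₁ × A₂, BR2p u₂ q.1 q.2 → u₂ q.1 q.2 = b) ∧
      (∀ q : A₁ × A₂, ¬ BR2p u₂ q.1 q.2 → u₂ q.1 q.2 < b)) ∧
    (∃ q q' : A₁ × A₂, BR2p u₂ q.1 q.2 ∧ BR2p u₂ q'.1 q'.2 ∧
      u₁ q.1 q.2 ≠ u₁ q'.1 q'.2 ∧ q.1 ≠ q'.1 ∧ q.2 ≠ q'.2) := by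
  obtain ⟨b, hb⟩ := hV2
  have hNash : ∀ q : A₁ × A₂, BR2p u₂ q.1 q.2 →
      (Mix.pure q.1, Mix.pure q.2) ∈ NashMM u₁ u₂ := by
    refine fun q hq => ⟨BR1p.br1m_pure fun i => ?_, hq.br2m_pure⟩
    by_contra hlt
    refine h2 ⟨q.1, Mix.pure q.2, i, ?_, hq.br2m_pure⟩
    simpa only [expPay_pure_pure, not_le] using hlt
  have hex : ∀ i, ∃ j, BR2p u₂ i j := fun i => Finite.exists_max (u₂ i)
  have huniq : ∀ {i j j'}, BR2p u₂ i j → BR2p u₂ i j' → j = j' := fun {i j j'} hj hj' => by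
    by_contra hne
    exact h3 ⟨i, j, j', hne, hj, hj'⟩
  have hval : ∀ q : A₁ × A₂, BR2p u₂ q.1 q.2 → u₂ q.1 q.2 = b := fun q hq => by
    have hmem : u₂ q.1 q.2 ∈ V2mm u₁ u₂ := ⟨_, hNash q hq, expPay_pure_pure u₂ q.1 q.2⟩
    rwa [hb] at hmem
  have hle : ∀ i j, u₂ i j ≤ b := fun i j => by
    obtain ⟨k, hk⟩ := hex i
    exact (hk j).trans_eq (hval (i, k) hk)
  have hbest : ∀ {i j}, u₂ i j = b → BR2p u₂ i j := fun {i j} h k => (hle i k).trans_eq h.symm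
  refine ⟨hNash, fun i => ?_, ⟨b, hval, fun q hq => (hle _ _).lt_of_ne fun h => hq (hbest h)⟩, ?_⟩
  · obtain ⟨j, hj⟩ := hex i
    exact ⟨j, hj, fun k hk => huniq hk hj⟩
  have hcol : ∀ {i i' j}, BR2p u₂ i' j → u₁ i j ≤ u₁ i' j := fun {i i' j} h => by
    simpa only [expPay_pure_pure] using (hNash (i', j) h).1 (Mix.pure i)
  by_contra hno
  obtain ⟨i₀⟩ : Nonempty A₁ := inferInstance
  obtain ⟨j₀, hj₀⟩ := hex i₀
  have hconst : ∀ {i j}, BR2p u₂ i j → u₁ i j = u₁ i₀ j₀ := fun {i j} hij => by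
    by_contra hne
    refine hno ⟨(i, j), (i₀, j₀), hij, hj₀, hne, ?_, ?_⟩
    · rintro rfl
      exact hne (by rw [huniq hij hj₀])
    · rintro rfl
      exact hne (le_antisymm (hcol hj₀) (hcol hij))
  have hpay : ∀ v ∈ V1mm u₁ u₂, v = u₁ i₀ j₀ := by
    rintro _ ⟨⟨σ₁, σ₂⟩, hσ, rfl⟩
    have hσb : expPay u₂ σ₁ σ₂ ∈ V2mm u₁ u₂ := ⟨_, hσ, rfl⟩
    rw [hb] at hσb
    refine Eq.trans (Finset.sum_congr rfl fun i _ => Finset.sum_congr rfl fun j _ => ?_)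
      (expPay_const σ₁ σ₂ (u₁ i₀ j₀))
    by_cases hij : σ₁.p i * σ₂.p j = 0
    · simp [hij]
    · rw [hconst (hbest (eq_of_expPay_eq_of_le hle hσb hij))]
  obtain ⟨v, hv, w, hw, hvw⟩ := hV1
  exact hvw ((hpay v hv).trans (hpay w hw).symm)

end TwoPlayer
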